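/- Let n be a positive integer. The map π ↦ Abs(π) from NC^B(n) to NC^A(n) is surjective, and every fiber has exactly n+1 elements; i.e., Abs is an (n+1)-to-1 map from NC^B(n) onto NC^A(n). -/

import Mathlib

open scoped Classical

namespace NCPB

/-- A collection of subsets of `α` is a partition: blocks are nonempty and
every element lies in exactly one block. -/
def IsPartition {α : Type*} (P : Set (Set α)) : Prop :=
  (∀ B ∈ P, B.Nonempty) ∧ ∀ a : α, ∃! B, B ∈ P ∧ a ∈ B

/-- The non-crossing condition for a collection of subsets of a linear order:
if `a < b < c < d`, `a, c` lie in a block `B` and `b, d` lie in a block `C`,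
then `b ∈ B` (i.e. the blocks coincide). -/
def IsNC {α : Type*} [LinearOrder α] (P : Set (Set α)) : Prop :=
  ∀ B ∈ P, ∀ C ∈ P, ∀ a b c d : α, a < b → b < c → c < d →
    a ∈ B → c ∈ B → b ∈ C → d ∈ C → b ∈ B

/-- A non-crossing partition of a linear order. -/
def NCPart {α : Type*} [LinearOrder α] (P : Set (Set α)) : Prop :=
  IsPartition P ∧ IsNC P

/-- The set `[±m] = {1 < 2 < ... < m < -1 < -2 < ... < -m}` is encoded as `Fin (2*m)`,
position `k < m` encoding `k+1` and position `m + j` encoding `-(j+1)`.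
`negMap` is the inversion map `a ↦ -a`. -/
def negMap (m : ℕ) (k : Fin (2*m)) : Fin (2*m) :=
  ⟨(k.val + m) % (2*m), Nat.mod_lt _ (Nat.lt_of_le_of_lt (Nat.zero_le _) k.isLt)⟩

/-- Image of a subset of `[±m]` under the inversion map, i.e. `X ↦ -X`. -/
def negSet (m : ℕ) (X : Set (Fin (2*m))) : Set (Fin (2*m)) := negMap m '' X

/-- The absolute value map `[±m] → {1,...,m}`, `±i ↦ i`. -/
def absMap (m : ℕ) (k : Fin (2*m)) : Fin m :=
  ⟨k.val % m, Nat.mod_lt _ (by have := k.isLt; omega)⟩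

/-- A non-crossing partition of type B: a non-crossing partition of `[±m]`
invariant under the inversion map. -/
def NCBPart (m : ℕ) (π : Set (Set (Fin (2*m)))) : Prop :=
  NCPart π ∧ ∀ B ∈ π, negSet m B ∈ π

/-- The collection of sets `Abs(X)`, `X` a block of `π`. -/
def absPart (m : ℕ) (π : Set (Set (Fin (2*m)))) : Set (Set (Fin m)) :=
  {F | ∃ X ∈ π, F = absMap m '' X}

/-- The embedding of `{1,...,m}` onto the odd-indexed positions of the interleaved
set `1 < 1̄ < 2 < 2̄ < ... < m < m̄` (encoded as `Fin (2*m)`): `i ↦ i` (even positions). -/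
def evens (m : ℕ) (i : Fin m) : Fin (2*m) := ⟨2*i.val, by have := i.isLt; omega⟩

/-- The embedding of the barred copy `{1̄,...,m̄}` into the interleaved set: odd positions. -/
def odds (m : ℕ) (i : Fin m) : Fin (2*m) := ⟨2*i.val+1, by have := i.isLt; omega⟩

/-- `P` refines... rather: every block of `P` is contained in a block of `Q`
(the partial order on partitions by reverse refinement: `P ≤ Q`). -/
def Refines {α : Type*} (P Q : Set (Set α)) : Prop := ∀ B ∈ P, ∃ C ∈ Q, B ⊆ C

/-- The collection `p ∪ q̄` of subsets of the interleaved set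
`1 < 1̄ < 2 < 2̄ < ... < m < m̄`, with `p` living on the unbarred copy and `q` on the
barred copy. -/
def interleave (m : ℕ) (p q : Set (Set (Fin m))) : Set (Set (Fin (2*m))) :=
  ((fun B => evens m '' B) '' p) ∪ ((fun B => odds m '' B) '' q)

/-- `q` is the Kreweras complement of `p`: `q` is the largest non-crossing partition
(in the reverse-refinement order) such that `p ∪ q̄` is a non-crossing partition of the
interleaved set `1 < 1̄ < ... < m < m̄`. -/
def IsKr (m : ℕ) (p q : Set (Set (Fin m))) : Prop :=
  NCPart q ∧ NCPart (interleave m p q) ∧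
  ∀ q', NCPart q' → NCPart (interleave m p q') → Refines q' q

/-- Two sets cross: there are `a < b < c < d` with `a, c ∈ B` and `b, d ∈ C`. -/
def Crossing {α : Type*} [LinearOrder α] (B C : Set α) : Prop :=
  ∃ a b c d : α, a < b ∧ b < c ∧ c < d ∧ a ∈ B ∧ c ∈ B ∧ b ∈ C ∧ d ∈ C

/-- Two members of a non-crossing family of pairwise disjoint sets: disjoint,
and neither crosses the other. -/
def PairNC {α : Type*} [LinearOrder α] (B C : Set α) : Prop :=
  Disjoint B C ∧ ¬ Crossing B C ∧ ¬ Crossing C B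

end NCPB

namespace NCPB

section Setoids

variable {α : Type*}

/-- A partition, in the sense of `IsPartition`, is the set of classes of a setoid. -/
lemma IsPartition.exists_classes {P : Set (Set α)} (h : IsPartition P) :
    ∃ s : Setoid α, s.classes = P := by
  have hP : Setoid.IsPartition P :=
    ⟨fun h0 => (h.1 ∅ h0).ne_empty rfl, fun a => h.2 a⟩
  exact ⟨Setoid.mkClasses P hP.2, Setoid.classes_mkClasses P hP⟩

lemma isPartition_classes (s : Setoid α) : IsPartition s.classes :=
  ⟨fun _ hB => Setoid.nonempty_of_mem_partition (Setoid.isPartition_classes s) hB,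
    fun a => (Setoid.isPartition_classes s).2 a⟩

lemma ncPart_classes_iff [LinearOrder α] (s : Setoid α) :
    NCPart s.classes ↔
      ∀ a b c d : α, a < b → b < c → c < d → s a c → s b d → s a b := by
  constructor
  · rintro ⟨-, h⟩ a b c d hab hbc hcd hac hbd
    exact s.symm' (h {x | s x a} ⟨a, rfl⟩ {x | s x b} ⟨b, rfl⟩ a b c d hab hbc hcd
      (s.refl' a) (s.symm' hac) (s.refl' b) (s.symm' hbd))
  · refine fun h => ⟨isPartition_classes s, ?_⟩
    rintro _ ⟨x, rfl⟩ _ ⟨y, rfl⟩ a b c d hab hbc hcd ha hc hb hd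
    exact s.trans' (s.symm' (h a b c d hab hbc hcd (s.trans' ha (s.symm' hc))
      (s.trans' hb (s.symm' hd)))) ha

end Setoids

variable {n : ℕ}

/-- The positive copy of `a` in `[±n]`. -/
def pos (a : Fin n) : Fin (2 * n) := ⟨a, by omega⟩

/-- The negative copy of `a` in `[±n]`. -/
def neg (a : Fin n) : Fin (2 * n) := ⟨a + n, by omega⟩

lemma eq_pos_or_eq_neg (x : Fin (2 * n)) : (∃ a : Fin n, x = pos a) ∨ ∃ a : Fin n, x = neg a := by
  by_cases h : x.val < n
  · exact Or.inl ⟨⟨x, h⟩, rfl⟩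
  · exact Or.inr ⟨⟨x - n, by omega⟩, Fin.ext (by simp only [neg]; omega)⟩

@[simp] lemma pos_lt_pos {a b : Fin n} : pos a < pos b ↔ a < b := Iff.rfl

@[simp] lemma neg_lt_neg {a b : Fin n} : neg a < neg b ↔ a < b := by
  simp only [neg, Fin.lt_def]; omega

@[simp] lemma pos_lt_neg (a b : Fin n) : pos a < neg b := by
  simp only [neg, pos, Fin.lt_def]; omega

@[simp] lemma not_neg_lt_pos (a b : Fin n) : ¬ neg a < pos b :=
  (pos_lt_neg b a).asymm

@[simp] lemma negMap_pos (a : Fin n) : negMap n (pos a) = neg a := by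
  simp only [negMap, pos, neg, Fin.mk.injEq]
  exact Nat.mod_eq_of_lt (by omega)

@[simp] lemma negMap_neg (a : Fin n) : negMap n (neg a) = pos a := by
  simp only [negMap, pos, neg, Fin.mk.injEq]
  rw [show a.val + n + n = a.val + 2 * n by ring, Nat.add_mod_right]
  exact Nat.mod_eq_of_lt (by omega)

@[simp] lemma absMap_pos (a : Fin n) : absMap n (pos a) = a :=
  Fin.ext (Nat.mod_eq_of_lt a.isLt)

@[simp] lemma absMap_neg (a : Fin n) : absMap n (neg a) = a := by
  ext
  simp only [absMap, neg, Nat.add_mod_right]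
  exact Nat.mod_eq_of_lt a.isLt

@[simp] lemma negMap_negMap (x : Fin (2 * n)) : negMap n (negMap n x) = x := by
  rcases eq_pos_or_eq_neg x with ⟨a, rfl⟩ | ⟨a, rfl⟩ <;> simp

@[simp] lemma absMap_negMap (x : Fin (2 * n)) : absMap n (negMap n x) = absMap n x := by
  rcases eq_pos_or_eq_neg x with ⟨a, rfl⟩ | ⟨a, rfl⟩ <;> simp

lemma absMap_eq_iff {x y : Fin (2 * n)} :
    absMap n x = absMap n y ↔ x = y ∨ x = negMap n y := by
  constructor
  · rcases eq_pos_or_eq_neg x with ⟨a, rfl⟩ | ⟨a, rfl⟩ <;>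
      rcases eq_pos_or_eq_neg y with ⟨b, rfl⟩ | ⟨b, rfl⟩ <;> simp +contextual
  · rintro (rfl | rfl) <;> simp

lemma ncbPart_classes_iff (s : Setoid (Fin (2 * n))) :
    NCBPart n s.classes ↔ NCPart s.classes ∧ ∀ x y, s x y → s (negMap n x) (negMap n y) := by
  refine and_congr_right fun _ => ⟨fun h x y hxy => ?_, ?_⟩
  · obtain ⟨z, hz⟩ := h {w | s w x} ⟨x, rfl⟩
    have key : ∀ w, s w x → s (negMap n w) z := fun w hw =>
      show negMap n w ∈ {w | s w z} from hz ▸ ⟨w, hw, rfl⟩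
    exact s.trans' (key x (s.refl' x)) (s.symm' (key y (s.symm' hxy)))
  · rintro h _ ⟨x, rfl⟩
    refine ⟨negMap n x, ?_⟩
    ext w
    constructor
    · rintro ⟨v, hv, rfl⟩
      exact h _ _ hv
    · intro hw
      exact ⟨negMap n w, by simpa using h _ _ hw, by simp⟩

lemma absPart_classes_eq_iff {s : Setoid (Fin (2 * n))} {t : Setoid (Fin n)} :
    absPart n s.classes = t.classes ↔
      ∀ x y, t (absMap n x) (absMap n y) ↔ s x y ∨ s x (negMap n y) := by
  constructor
  · intro h x y
    have hx : absMap n '' {w | s w x} ∈ t.classes := h ▸ ⟨_, ⟨x, rfl⟩, rfl⟩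
    obtain ⟨z, hz⟩ := hx
    have hxz : t (absMap n x) z := by
      change absMap n x ∈ {w | t w z}
      exact hz ▸ ⟨x, s.refl' x, rfl⟩
    have key : ∀ b, t (absMap n x) b ↔ ∃ w, s w x ∧ absMap n w = b := by
      intro b
      have : b ∈ absMap n '' {w | s w x} ↔ t b z := by rw [hz]; rfl
      exact ⟨fun hb => this.2 (t.trans' (t.symm' hb) hxz),
        fun hb => t.trans' hxz (t.symm' (this.1 hb))⟩
    rw [key]
    constructor
    · rintro ⟨w, hw, hwy⟩
      rcases absMap_eq_iff.1 hwy with rfl | rfl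
      · exact Or.inl (s.symm' hw)
      · exact Or.inr (s.symm' hw)
    · rintro (hy | hy)
      · exact ⟨y, s.symm' hy, rfl⟩
      · exact ⟨negMap n y, s.symm' hy, by simp⟩
  · intro h
    have key : ∀ x, absMap n '' {w | s w x} = {b | t b (absMap n x)} := by
      intro x
      ext b
      constructor
      · rintro ⟨w, hw, rfl⟩
        exact (h w x).2 (Or.inl hw)
      · intro hb
        rcases (h x (pos b)).1 (by simpa using t.symm' hb) with hb | hb
        · exact ⟨pos b, s.symm' hb, by simp⟩
        · exact ⟨_, s.symm' hb, by simp⟩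
    ext F
    constructor
    · rintro ⟨_, ⟨x, rfl⟩, rfl⟩
      exact ⟨absMap n x, key x⟩
    · rintro ⟨a, rfl⟩
      exact ⟨_, ⟨pos a, rfl⟩, by rw [key, absMap_pos]⟩

/-- `g` is the minimum of the class of `a`. -/
def IsMinOf (t : Setoid (Fin n)) (g : ℕ) (a : Fin n) : Prop :=
  ∃ h : g < n, t a ⟨g, h⟩ ∧ ∀ b, t b ⟨g, h⟩ → g ≤ b

lemma IsMinOf.congr {t : Setoid (Fin n)} {g : ℕ} {a b : Fin n} (h : t a b)
    (ha : IsMinOf t g a) : IsMinOf t g b := by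
  obtain ⟨hg, hag, hmin⟩ := ha
  exact ⟨hg, t.trans' (t.symm' h) hag, hmin⟩

/-- Whether `x` lies in the half-turn `g + 1, ..., n, -1, ..., -g` of `[±n]`. -/
def InHalf (g : ℕ) (x : Fin (2 * n)) : Prop := x.val < n ↔ g ≤ (absMap n x).val

@[simp] lemma inHalf_pos {g : ℕ} {a : Fin n} : InHalf g (pos a) ↔ g ≤ a.val := by
  simp [InHalf]; simp [pos]

@[simp] lemma inHalf_neg {g : ℕ} {a : Fin n} : InHalf g (neg a) ↔ ¬ g ≤ a.val := by
  simp [InHalf]; simp [neg]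

/-- The lift of `t` to `[±n]` obtained by copying `t` on the half-turn `g + 1, ..., n, -1, ..., -g`
and on its opposite, and merging the two copies of the class with minimum `g`, if there is one. -/
def lift (t : Setoid (Fin n)) (g : ℕ) : Setoid (Fin (2 * n)) where
  r x y := t (absMap n x) (absMap n y) ∧
    ((InHalf g x ↔ InHalf g y) ∨ IsMinOf t g (absMap n x))
  iseqv :=
    { refl := fun x => ⟨t.refl' _, Or.inl Iff.rfl⟩
      symm := fun ⟨h, h'⟩ => ⟨t.symm' h, h'.imp Iff.symm (IsMinOf.congr h)⟩
      trans := fun ⟨h₁, h₁'⟩ ⟨h₂, h₂'⟩ => ⟨t.trans' h₁ h₂, by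
        rcases h₁' with h₁' | h₁'
        · exact h₂'.imp h₁'.trans (IsMinOf.congr (t.symm' h₁))
        · exact Or.inr h₁'⟩ }

lemma lift_apply {t : Setoid (Fin n)} {g : ℕ} {x y : Fin (2 * n)} :
    lift t g x y ↔ t (absMap n x) (absMap n y) ∧
      ((InHalf g x ↔ InHalf g y) ∨ IsMinOf t g (absMap n x)) := Iff.rfl

lemma inHalf_negMap {g : ℕ} {x : Fin (2 * n)} : InHalf g (negMap n x) ↔ ¬ InHalf g x := by
  rcases eq_pos_or_eq_neg x with ⟨a, rfl⟩ | ⟨a, rfl⟩ <;> simp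

lemma absPart_lift (t : Setoid (Fin n)) (g : ℕ) : absPart n (lift t g).classes = t.classes := by
  rw [absPart_classes_eq_iff]
  intro x y
  simp only [lift_apply, absMap_negMap, inHalf_negMap]
  tauto

lemma lift_nc {t : Setoid (Fin n)}
    (ht : ∀ a b c d : Fin n, a < b → b < c → c < d → t a c → t b d → t a b) (g : ℕ)
    (x y z w : Fin (2 * n)) (hxy : x < y) (hyz : y < z) (hzw : z < w)
    (hxz : lift t g x z) (hyw : lift t g y w) : lift t g x y := by
  have hs : ∀ a b, t a b → t b a := fun a b => t.symm'
  have htr : ∀ a b c, t a b → t b c → t a c := fun a b c => t.trans'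
  have hr : ∀ a, t a a := t.refl'
  have hZ : ∀ a b, t a b → IsMinOf t g a → IsMinOf t g b := fun a b => IsMinOf.congr
  rw [lift_apply] at *
  rcases eq_pos_or_eq_neg x with ⟨a, rfl⟩ | ⟨a, rfl⟩ <;>
  rcases eq_pos_or_eq_neg y with ⟨b, rfl⟩ | ⟨b, rfl⟩ <;>
  rcases eq_pos_or_eq_neg z with ⟨c, rfl⟩ | ⟨c, rfl⟩ <;>
  rcases eq_pos_or_eq_neg w with ⟨d, rfl⟩ | ⟨d, rfl⟩ <;>
  simp only [pos_lt_pos, neg_lt_neg, not_neg_lt_pos, pos_lt_neg, absMap_pos, absMap_neg,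
    inHalf_pos, inHalf_neg] at * <;>
  obtain ⟨hac, hac'⟩ := hxz <;> obtain ⟨hbd, hbd'⟩ := hyw
  all_goals
    by_cases hab : t a b
    · by_cases hZa : IsMinOf t g a
      · exact ⟨hab, Or.inr hZa⟩
      · have hZb : ¬ IsMinOf t g b := fun h => hZa (hZ _ _ (hs _ _ hab) h)
        simp only [hZa, hZb, or_false] at hac' hbd' ⊢
        refine ⟨hab, ?_⟩
        clear ht hs htr hr hZ
        omega
    · exfalso
      by_cases hZa : IsMinOf t g a
      · have hZb : ¬ IsMinOf t g b := fun hZb => by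
          obtain ⟨_, h₁, _⟩ := hZa
          obtain ⟨_, h₂, _⟩ := hZb
          exact hab (htr _ _ _ h₁ (hs _ _ h₂))
        obtain ⟨hg, h₁, h₂⟩ := hZa
        have := h₂ a h₁
        have := h₂ c (htr _ _ _ (hs _ _ hac) h₁)
        simp only [hZb, or_false] at hbd'
        generalize hk : (⟨g, hg⟩ : Fin n) = k at *
        have hk' : k.val = g := by rw [← hk]
        subst hk'
        grind
      · by_cases hZb : IsMinOf t g b
        · obtain ⟨hg, h₁, h₂⟩ := hZb
          have := h₂ b h₁
          have := h₂ d (htr _ _ _ (hs _ _ hbd) h₁)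
          simp only [hZa, or_false] at hac'
          generalize hk : (⟨g, hg⟩ : Fin n) = k at *
          have hk' : k.val = g := by rw [← hk]
          subst hk'
          grind
        · simp only [hZa, hZb, or_false] at hac' hbd'
          clear hZ hZa hZb
          grind

lemma ncbPart_lift {t : Setoid (Fin n)} (ht : NCPart t.classes) (g : ℕ) :
    NCBPart n (lift t g).classes := by
  rw [ncPart_classes_iff] at ht
  rw [ncbPart_classes_iff, ncPart_classes_iff]
  refine ⟨lift_nc ht g, fun x y h => ?_⟩
  simp only [lift_apply, absMap_negMap, inHalf_negMap] at h ⊢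
  tauto

lemma lift_ne_lift (t : Setoid (Fin n)) {g h : ℕ} (hgh : g < h) (hh : h ≤ n) :
    lift t g ≠ lift t h := by
  intro heq
  have hg : g < n := by omega
  obtain ⟨b, hbg, hb⟩ : ∃ b : Fin n, b.val ≤ g ∧ lift t g (pos b) (neg ⟨g, hg⟩) := by
    by_cases hmin : ∀ b, t b ⟨g, hg⟩ → g ≤ b.val
    · exact ⟨⟨g, hg⟩, le_rfl, by
        simp only [lift_apply, absMap_pos, absMap_neg]
        exact ⟨t.refl' _, Or.inr ⟨hg, t.refl' _, hmin⟩⟩⟩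
    · push Not at hmin
      obtain ⟨b, hb, hbg⟩ := hmin
      exact ⟨b, hbg.le, by simp [lift_apply, hb, hbg]⟩
  rw [heq] at hb
  simp only [lift_apply, absMap_pos, absMap_neg, inHalf_pos, inHalf_neg] at hb
  rcases hb.2 with h' | ⟨h₁, h₂, h₃⟩
  · omega
  · have := h₃ b h₂
    omega

lemma threshold_iff {T A B P Q Z : Prop} (hT : T ↔ A ∨ B) (hA : A → (P ↔ Q))
    (hB : B → (P ↔ ¬ Q)) (hZ : ¬ Z) :
    (A ↔ T ∧ ((P ↔ Q) ∨ Z)) ∧ (B ↔ T ∧ ((P ↔ ¬ Q) ∨ Z)) := by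
  by_cases P <;> by_cases Q <;> simp_all

/-- The combinatorial heart of the description of the fibers: the relations `A` (same sign) and `B`
(opposite sign) that a symmetric non-crossing partition of `[±n]` induces on its absolute values
are cut out by a single threshold `g`. -/
lemma exists_cut {t : Setoid (Fin n)} {A B : Fin n → Fin n → Prop}
    (ht : ∀ a b, t a b ↔ A a b ∨ B a b)
    (nc₀ : ∀ a b c d, a < b → b < c → c < d → A a c → A b d → A a b)
    (nc₁ : ∀ a b c d, a < b → b < c → A a c → B b d → A a b)
    (nc₂ : ∀ a b c d, a < b → c < d → B a c → B b d → A a b)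
    (As : ∀ a b, A a b → A b a) (Bs : ∀ a b, B a b → B b a)
    (AB : ∀ a b c, A a b → B b c → B a c) (BB : ∀ a b c, B a b → B b c → A a c) :
    ∃ g ≤ n, ∀ a b,
      (A a b ↔ t a b ∧ ((g ≤ a.val ↔ g ≤ b.val) ∨ IsMinOf t g a)) ∧
      (B a b ↔ t a b ∧ ((g ≤ a.val ↔ ¬ g ≤ b.val) ∨ IsMinOf t g a)) := by
  by_cases hz : ∃ a, B a a
  · obtain ⟨g, hg, hmin⟩ := WellFounded.has_min wellFounded_lt {a | B a a} hz
    simp only [Set.mem_ofPred_eq, not_lt] at hg hmin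
    have hB : ∀ a, t a g → B a a := fun a h => by
      rcases (ht a g).1 h with h | h
      · exact AB _ _ _ h (Bs _ _ (AB _ _ _ h hg))
      · exact AB _ _ _ (BB _ _ _ h hg) (Bs _ _ h)
    have hB' : ∀ a, B a a → t a g := fun a h => by
      rcases (hmin a h).eq_or_lt with rfl | h'
      · exact t.refl' _
      · exact (ht a g).2 (Or.inl (As _ _ (nc₂ _ _ _ _ h' h' hg h)))
    have hZ : ∀ a, IsMinOf t g a ↔ B a a := fun a =>
      ⟨fun ⟨_, h, _⟩ => hB a h, fun h => ⟨g.isLt, hB' a h, fun b hb => hmin b (hB b hb)⟩⟩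
    refine ⟨g, g.isLt.le, fun a b => ?_⟩
    rw [hZ]
    by_cases ha : B a a
    · have hAB : A a b ↔ B a b :=
        ⟨fun h => Bs _ _ (AB _ _ _ (As _ _ h) ha), fun h => BB _ _ _ ha h⟩
      simp [ht, ha, hAB]
    · have hb : t a b → ¬ B b b := fun h h' => ha (hB a (t.trans' h (hB' b h')))
      have hAB : A a b → ¬ B a b := fun h h' => ha (AB _ _ _ h (Bs _ _ h'))
      have hag : ¬ t a g := fun h => ha (hB a h)
      have hbg : t a b → ¬ t b g := fun h h' => hb h (hB b h')
      have hag' : a ≠ g := fun h => ha (h ▸ hg)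
      have hbg' : t a b → b ≠ g := fun h h' => hb h (h' ▸ hg)
      have key₁ : A a b → (g.val ≤ a.val ↔ g.val ≤ b.val) := by grind
      have key₂ : B a b → (g.val ≤ a.val ↔ ¬ g.val ≤ b.val) := by grind
      exact threshold_iff (ht a b) key₁ key₂ ha
  · push Not at hz
    have hAB : ∀ a b, A a b → ¬ B a b := fun a b h h' => hz a (AB _ _ _ h (Bs _ _ h'))
    by_cases hex : ∃ b a, a < b ∧ B a b
    · obtain ⟨g, ⟨h, hhg, hB⟩, hmin⟩ :=
        WellFounded.has_min wellFounded_lt {b | ∃ a, a < b ∧ B a b} hex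
      have hmin' : ∀ a b, a < b → B a b → g ≤ b := fun a b hab hb =>
        not_lt.1 (hmin b ⟨a, hab, hb⟩)
      have hZ : ∀ a, ¬ IsMinOf t g a := by
        rintro a ⟨_, -, h'⟩
        have := h' h ((ht _ _).2 (Or.inr hB))
        omega
      have key₁ : ∀ a b, a < b → B a b → a < g := by
        intro a b hab hb
        by_contra! hga
        have hha : A h a := nc₂ h a g b (by omega) (by omega) hB hb
        rcases hga.eq_or_lt with rfl | hga
        · exact hAB _ _ hha hB
        · have hag : B a g := AB _ _ _ (As _ _ hha) hB
          have hgb : A g b := BB _ _ _ (Bs _ _ hag) hb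
          exact hAB _ _ (nc₀ _ _ _ _ hhg hga hab hha hgb) hB
      have key₂ : ∀ a b, a < g → g ≤ b → ¬ A a b := by
        intro a b hag hgb hA
        have hne : ¬ A a g := by
          intro hA
          have hBa : B a h := AB _ _ _ hA (Bs _ _ hB)
          rcases lt_trichotomy a h with h' | rfl | h'
          · exact (hmin' _ _ h' hBa).not_gt hhg
          · exact hz _ hBa
          · exact (hmin' _ _ h' (Bs _ _ hBa)).not_gt hag
        rcases hgb.eq_or_lt with rfl | hgb
        · exact hne hA
        · exact hne (nc₁ _ _ _ _ hag hgb hA (Bs _ _ hB))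
      refine ⟨g, g.isLt.le, fun a b => ?_⟩
      have hA : A a b → (g.val ≤ a.val ↔ g.val ≤ b.val) := by grind
      have hB : B a b → (g.val ≤ a.val ↔ ¬ g.val ≤ b.val) := by grind
      exact threshold_iff (ht a b) hA hB (hZ a)
    · push Not at hex
      have hB : ∀ a b, ¬ B a b := fun a b h => by
        rcases lt_trichotomy a b with h' | rfl | h'
        · exact hex _ _ h' h
        · exact hz _ h
        · exact hex _ _ h' (Bs _ _ h)
      refine ⟨n, le_rfl, fun a b => ?_⟩
      have hZ : ¬ IsMinOf t n a := fun ⟨h, _⟩ => h.false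
      exact threshold_iff (ht a b) (fun _ => by omega) (fun h => absurd h (hB a b)) hZ

lemma exists_eq_lift {t : Setoid (Fin n)} {s : Setoid (Fin (2 * n))}
    (hnc : ∀ x y z w, x < y → y < z → z < w → s x z → s y w → s x y)
    (hneg : ∀ x y, s x y → s (negMap n x) (negMap n y))
    (habs : ∀ x y, t (absMap n x) (absMap n y) ↔ s x y ∨ s x (negMap n y)) :
    ∃ g ≤ n, s = lift t g := by
  have hpn : ∀ a b, s (neg a) (pos b) ↔ s (pos a) (neg b) := fun a b =>
    ⟨fun h => by simpa using hneg _ _ h, fun h => by simpa using hneg _ _ h⟩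
  have hnn : ∀ a b, s (neg a) (neg b) ↔ s (pos a) (pos b) := fun a b =>
    ⟨fun h => by simpa using hneg _ _ h, fun h => by simpa using hneg _ _ h⟩
  have ht : ∀ a b, t a b ↔ s (pos a) (pos b) ∨ s (pos a) (neg b) := fun a b => by
    simpa using habs (pos a) (pos b)
  suffices H : ∃ g ≤ n, ∀ a b, (s (pos a) (pos b) ↔ t a b ∧
      ((g ≤ a.val ↔ g ≤ b.val) ∨ IsMinOf t g a)) ∧ (s (pos a) (neg b) ↔ t a b ∧
      ((g ≤ a.val ↔ ¬ g ≤ b.val) ∨ IsMinOf t g a)) by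
    obtain ⟨g, hg, H⟩ := H
    refine ⟨g, hg, Setoid.ext fun x y => ?_⟩
    rw [lift_apply]
    rcases eq_pos_or_eq_neg x with ⟨a, rfl⟩ | ⟨a, rfl⟩ <;>
    rcases eq_pos_or_eq_neg y with ⟨b, rfl⟩ | ⟨b, rfl⟩ <;>
    simp only [absMap_pos, absMap_neg, inHalf_pos, inHalf_neg, hpn, hnn, H] <;> tauto
  refine exists_cut (A := fun a b => s (pos a) (pos b)) (B := fun a b => s (pos a) (neg b)) ht
    (fun a b c d h₁ h₂ h₃ => hnc _ _ _ _ h₁ h₂ h₃)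
    (fun a b c d h₁ h₂ => hnc _ _ _ _ (pos_lt_pos.2 h₁) (pos_lt_pos.2 h₂) (pos_lt_neg _ _))
    (fun a b c d h₁ h₂ => hnc _ _ _ _ (pos_lt_pos.2 h₁) (pos_lt_neg _ _) (neg_lt_neg.2 h₂))
    (fun a b => s.symm') (fun a b h => (hpn _ _).1 (s.symm' h))
    (fun a b c => s.trans') (fun a b c h h' => s.trans' h ((hpn b c).2 h'))

end NCPB

open NCPB in
/-- The absolute-value map `NC^B(n) → NC^A(n)` is surjective and each
fiber has exactly `n+1` elements. -/
theorem absPart_surjective_and_fiber_card (n : ℕ) (hn : 0 < n)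
    (p : Set (Set (Fin n))) (hp : NCPart p) :
    (∃ π, NCBPart n π ∧ absPart n π = p) ∧
    {π | NCBPart n π ∧ absPart n π = p}.ncard = n + 1 := by
  obtain ⟨t, rfl⟩ := hp.1.exists_classes
  have hrange : {π | NCBPart n π ∧ absPart n π = t.classes} =
      Set.range fun g : Fin (n + 1) => (lift t g).classes := by
    ext π
    constructor
    · rintro ⟨hπ, habs⟩
      obtain ⟨s, rfl⟩ := hπ.1.1.exists_classes
      rw [ncbPart_classes_iff, ncPart_classes_iff] at hπ
      obtain ⟨g, hg, rfl⟩ := exists_eq_lift hπ.1 hπ.2 (absPart_classes_eq_iff.1 habs)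
      exact ⟨⟨g, by omega⟩, rfl⟩
    · rintro ⟨g, rfl⟩
      exact ⟨ncbPart_lift hp g, absPart_lift t g⟩
  have hinj : Function.Injective fun g : Fin (n + 1) => (lift t g).classes := by
    intro g h hgh
    have heq : lift t g = lift t h := Setoid.classes_inj.2 hgh
    by_contra hne
    rcases lt_or_gt_of_ne hne with hlt | hlt
    · exact lift_ne_lift t hlt (by omega) heq
    · exact lift_ne_lift t hlt (by omega) heq.symm
  refine ⟨⟨_, ncbPart_lift hp 0, absPart_lift t 0⟩, ?_⟩
  rw [hrange, ← Set.image_univ, Set.ncard_image_of_injective _ hinj, Set.ncard_univ,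
    Nat.card_fin]
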